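/- arXiv:2106.06338 — 6 statements merged into one kernel-verified Lean document; each statement's English description precedes it below -/
import Mathlib

section
/- Assume z* ∈ ℝⁿ and s ∈ ℝⁿ satisfy the Lasso first-order optimality condition Dᵀ(Dz* − y) + λs = 0 with s_i = sign(z*_i) for every i ∈ S* := supp(z*) and |s_i| ≤ 1 for all i. Let z ∈ ℝⁿ with supp(z) = S* and sign(z_i) = sign(z*_i) for all i ∈ S*. Let J = (J_l)_{l=1}^m be any family of n×n real matrices. Define the automatic-differentiation gradient estimate g² ∈ ℝ^{m×n} whose l-th row is (Dz − y)_l zᵀ + ((J_l)ᵀ(Dᵀ(Dz − y) + λs))ᵀ, and the exact gradient g* = (Dz* − y)(z*)ᵀ. Then ‖g² − g*‖_F ≤ ‖R(J, S*)‖ · ‖z − z*‖ + ‖D‖ · ‖z − z*‖², where ‖R(J, S*)‖ is the operator norm of the linear map R(J, S*) from (ℝⁿ, ‖·‖₂) to (ℝ^{m×n}, ‖·‖_F). -/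
open scoped BigOperators
open Matrix

noncomputable def eunorm {α : Type*} [Fintype α] (v : α → ℝ) : ℝ :=
  Real.sqrt (∑ i, v i ^ 2)

noncomputable def frobnorm {α β : Type*} [Fintype α] [Fintype β] (A : Matrix α β ℝ) : ℝ :=
  Real.sqrt (∑ i, ∑ j, A i j ^ 2)

noncomputable def l2opnorm {α β : Type*} [Fintype α] [Fintype β] (A : Matrix α β ℝ) : ℝ :=
  sInf {c : ℝ | 0 ≤ c ∧ ∀ v : β → ℝ, eunorm (A.mulVec v) ≤ c * eunorm v}

open scoped Classical in
noncomputable def supp {n : ℕ} (z : Fin n → ℝ) : Finset (Fin n) :=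
  Finset.univ.filter fun i => z i ≠ 0

noncomputable def rowMask {n : ℕ} (S : Finset (Fin n)) (M : Matrix (Fin n) (Fin n) ℝ) :
    Matrix (Fin n) (Fin n) ℝ :=
  Matrix.of fun i j => if i ∈ S then M i j else 0

def restrVec {n : ℕ} (S : Finset (Fin n)) (h : Fin n → ℝ) : Fin n → ℝ :=
  fun i => if i ∈ S then h i else 0

def colSub {m n : ℕ} (D : Matrix (Fin m) (Fin n) ℝ) (S : Finset (Fin n)) :
    Matrix (Fin m) {i // i ∈ S} ℝ :=
  D.submatrix id Subtype.val

noncomputable def gram {m n : ℕ} (D : Matrix (Fin m) (Fin n) ℝ) (S : Finset (Fin n)) :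
    Matrix {i // i ∈ S} {i // i ∈ S} ℝ :=
  (colSub D S)ᵀ * colSub D S

noncomputable def Nmat {m n : ℕ} (D : Matrix (Fin m) (Fin n) ℝ) (y : Fin m → ℝ)
    (l : Fin m) (z : Fin n → ℝ) : Matrix (Fin n) (Fin n) ℝ :=
  Matrix.vecMulVec (D l) z + (dotProduct (D l) z - y l) • (1 : Matrix (Fin n) (Fin n) ℝ)

noncomputable def umat {m n : ℕ} (D : Matrix (Fin m) (Fin n) ℝ) (y : Fin m → ℝ)
    (l : Fin m) (L : ℝ) (z : Fin n → ℝ) : Matrix (Fin n) (Fin n) ℝ :=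
  (-(1 / L)) • Nmat D y l z

noncomputable def Gmat {m n : ℕ} (D : Matrix (Fin m) (Fin n) ℝ) (L : ℝ) :
    Matrix (Fin n) (Fin n) ℝ :=
  1 - (1 / L) • (Dᵀ * D)

noncomputable def Jstar {m n : ℕ} (D : Matrix (Fin m) (Fin n) ℝ) (y : Fin m → ℝ)
    (l : Fin m) (z : Fin n → ℝ) (S : Finset (Fin n)) : Matrix (Fin n) (Fin n) ℝ :=
  Matrix.of fun i j =>
    if h : i ∈ S then
      (-((gram D S)⁻¹ * (Nmat D y l z).submatrix (Subtype.val : {i // i ∈ S} → Fin n) id))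
        ⟨i, h⟩ j
    else 0

noncomputable def Rmap {m n : ℕ} (D : Matrix (Fin m) (Fin n) ℝ) (y : Fin m → ℝ)
    (zstar : Fin n → ℝ) (J : Fin m → Matrix (Fin n) (Fin n) ℝ) (S : Finset (Fin n))
    (h : Fin n → ℝ) : Matrix (Fin m) (Fin n) ℝ :=
  Matrix.of fun l j =>
    ((J l)ᵀ.mulVec ((Dᵀ * D).mulVec (restrVec S h))) j
      + (D.mulVec (restrVec S h)) l * zstar j
      + (D.mulVec zstar - y) l * restrVec S h j

noncomputable def mapOpNorm {m n : ℕ} (Φ : (Fin n → ℝ) → Matrix (Fin m) (Fin n) ℝ) : ℝ :=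
  sInf {c : ℝ | 0 ≤ c ∧ ∀ h : Fin n → ℝ, frobnorm (Φ h) ≤ c * eunorm h}

noncomputable def Mmat {m n : ℕ} (D : Matrix (Fin m) (Fin n) ℝ) (Sstar E : Finset (Fin n))
    (U : Matrix (Fin n) (Fin n) ℝ) : Matrix (Fin n) (Fin n) ℝ :=
  Matrix.of fun i j =>
    if h : i ∈ E then
      U i j -
        ((colSub D E)ᵀ * colSub D Sstar * (gram D Sstar)⁻¹ *
          U.submatrix (Subtype.val : {i // i ∈ Sstar} → Fin n) id) ⟨i, h⟩ j
    else 0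

noncomputable def Cmat {m n : ℕ} (D : Matrix (Fin m) (Fin n) ℝ) (Sstar E : Finset (Fin n)) :
    Matrix (Fin n) (Fin n) ℝ :=
  Matrix.of fun i j =>
    if h : i ∈ E then
      if h' : j ∈ Sstar then
        ((colSub D E)ᵀ * colSub D Sstar * (gram D Sstar)⁻¹) ⟨i, h⟩ ⟨j, h'⟩
      else 0
    else 0

noncomputable def Pdiag {n : ℕ} (S : Finset (Fin n)) : Matrix (Fin n) (Fin n) ℝ :=
  Matrix.diagonal fun i => if i ∈ S then (1 : ℝ) else 0

noncomputable def STv {n : ℕ} (μ : ℝ) (x : Fin n → ℝ) : Fin n → ℝ :=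
  fun i => Real.sign (x i) * max (|x i| - μ) 0
open WithLp in
theorem eunorm_eq_norm {α : Type*} [Fintype α] (v : α → ℝ) : eunorm v = ‖toLp 2 v‖ := by
  simp [eunorm, EuclideanSpace.norm_eq]

theorem eunorm_nonneg {α : Type*} [Fintype α] (v : α → ℝ) : 0 ≤ eunorm v :=
  Real.sqrt_nonneg _

theorem frobnorm_eq_eunorm {α β : Type*} [Fintype α] [Fintype β] (A : Matrix α β ℝ) :
    frobnorm A = eunorm fun p : α × β => A p.1 p.2 := by
  simp [frobnorm, eunorm, Fintype.sum_prod_type]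

theorem frobnorm_add_le {α β : Type*} [Fintype α] [Fintype β] (A B : Matrix α β ℝ) :
    frobnorm (A + B) ≤ frobnorm A + frobnorm B := by
  simp only [frobnorm_eq_eunorm, eunorm_eq_norm]
  exact norm_add_le (WithLp.toLp 2 fun p : α × β => A p.1 p.2)
    (WithLp.toLp 2 fun p : α × β => B p.1 p.2)

theorem frobnorm_vecMulVec {α β : Type*} [Fintype α] [Fintype β] (a : α → ℝ) (b : β → ℝ) :
    frobnorm (vecMulVec a b) = eunorm a * eunorm b := by
  rw [frobnorm, eunorm, eunorm, ← Real.sqrt_mul (Finset.sum_nonneg fun i _ => sq_nonneg (a i)),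
    Finset.sum_mul_sum]
  simp [vecMulVec_apply, mul_pow]

theorem exists_eunorm_map_le {α β : Type*} [Fintype α] [Fintype β]
    (T : (α → ℝ) →ₗ[ℝ] (β → ℝ)) :
    ∃ c : ℝ, 0 ≤ c ∧ ∀ v, eunorm (T v) ≤ c * eunorm v := by
  let F : EuclideanSpace ℝ α →L[ℝ] EuclideanSpace ℝ β :=
    LinearMap.toContinuousLinearMap
      ((WithLp.linearEquiv 2 ℝ (β → ℝ)).symm.toLinearMap ∘ₗ T ∘ₗ
        (WithLp.linearEquiv 2 ℝ (α → ℝ)).toLinearMap)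
  refine ⟨‖F‖, norm_nonneg _, fun v => ?_⟩
  rw [eunorm_eq_norm, eunorm_eq_norm]
  exact F.le_opNorm (WithLp.toLp 2 v)

theorem le_sInf_mul_of_forall_le {S : Set ℝ} (hS : S.Nonempty) {a b : ℝ} (hb : 0 ≤ b)
    (h : ∀ c ∈ S, a ≤ c * b) : a ≤ sInf S * b := by
  rcases hb.eq_or_lt with rfl | hb
  · obtain ⟨c, hc⟩ := hS
    simpa using h c hc
  · rw [← div_le_iff₀ hb]
    exact le_csInf hS fun c hc => (div_le_iff₀ hb).2 (h c hc)

theorem eunorm_mulVec_le {α β : Type*} [Fintype α] [Fintype β] (A : Matrix α β ℝ) (v : β → ℝ) :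
    eunorm (A.mulVec v) ≤ l2opnorm A * eunorm v :=
  le_sInf_mul_of_forall_le (exists_eunorm_map_le A.mulVecLin) (eunorm_nonneg v)
    fun _ hc => hc.2 v

theorem frobnorm_map_le {m n : ℕ} (T : (Fin n → ℝ) →ₗ[ℝ] Matrix (Fin m) (Fin n) ℝ)
    (h : Fin n → ℝ) : frobnorm (T h) ≤ mapOpNorm T * eunorm h := by
  refine le_sInf_mul_of_forall_le ?_ (eunorm_nonneg h) fun _ hc => hc.2 h
  obtain ⟨c, hc, hT⟩ := exists_eunorm_map_le
    (LinearMap.pi fun p : Fin m × Fin n => Matrix.entryLinearMap ℝ ℝ p.1 p.2 ∘ₗ T)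
  refine ⟨c, hc, fun v => ?_⟩
  rw [frobnorm_eq_eunorm]
  exact hT v

theorem restrVec_add {n : ℕ} (S : Finset (Fin n)) (h k : Fin n → ℝ) :
    restrVec S (h + k) = restrVec S h + restrVec S k := by
  ext i
  by_cases hi : i ∈ S <;> simp [restrVec, hi]

theorem restrVec_smul {n : ℕ} (S : Finset (Fin n)) (c : ℝ) (h : Fin n → ℝ) :
    restrVec S (c • h) = c • restrVec S h := by
  ext i
  by_cases hi : i ∈ S <;> simp [restrVec, hi]

theorem restrVec_eq_self {n : ℕ} {S : Finset (Fin n)} {h : Fin n → ℝ}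
    (hS : ∀ i ∉ S, h i = 0) : restrVec S h = h := by
  ext i
  by_cases hi : i ∈ S <;> simp [restrVec, hi, hS]

/-- `Rmap` bundled as a linear map. -/
noncomputable def RmapLin {m n : ℕ} (D : Matrix (Fin m) (Fin n) ℝ) (y : Fin m → ℝ)
    (zstar : Fin n → ℝ) (J : Fin m → Matrix (Fin n) (Fin n) ℝ) (S : Finset (Fin n)) :
    (Fin n → ℝ) →ₗ[ℝ] Matrix (Fin m) (Fin n) ℝ where
  toFun := Rmap D y zstar J S
  map_add' h k := by
    ext l j
    simp only [Rmap, restrVec_add, mulVec_add, of_apply, Matrix.add_apply, Pi.add_apply]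
    ring
  map_smul' c h := by
    ext l j
    simp only [Rmap, restrVec_smul, mulVec_smul, of_apply, Matrix.smul_apply, Pi.smul_apply,
      smul_eq_mul, RingHom.id_apply]
    ring

/-- bound on the automatic-differentiation gradient estimate on the
support (Proposition 3 of the paper). -/
theorem autodiff_gradient_bound_on_support
    {m n : ℕ} (D : Matrix (Fin m) (Fin n) ℝ) (y : Fin m → ℝ)
    (lam : ℝ) (hlam : 0 < lam)
    (zstar s : Fin n → ℝ)
    (hopt : Dᵀ.mulVec (D.mulVec zstar - y) + lam • s = 0)
    (hsign : ∀ i, zstar i ≠ 0 → s i = Real.sign (zstar i))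
    (hsub : ∀ i, |s i| ≤ 1)
    (z : Fin n → ℝ)
    (hsupp : ∀ i, z i ≠ 0 ↔ zstar i ≠ 0)
    (hsgn : ∀ i, zstar i ≠ 0 → Real.sign (z i) = Real.sign (zstar i))
    (J : Fin m → Matrix (Fin n) (Fin n) ℝ)
    (g2 gstar : Matrix (Fin m) (Fin n) ℝ)
    (hg2 : g2 = Matrix.of fun l j => (D.mulVec z - y) l * z j
      + ((J l)ᵀ.mulVec (Dᵀ.mulVec (D.mulVec z - y) + lam • s)) j)
    (hgstar : gstar = Matrix.vecMulVec (D.mulVec zstar - y) zstar) :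
    frobnorm (g2 - gstar) ≤
      mapOpNorm (Rmap D y zstar J (supp zstar)) * eunorm (z - zstar)
        + l2opnorm D * eunorm (z - zstar) ^ 2 := by
  have hres : restrVec (supp zstar) (z - zstar) = z - zstar := by
    refine restrVec_eq_self fun i hi => ?_
    have hzs : zstar i = 0 := by simpa [supp] using hi
    have hz : z i = 0 := not_not.1 fun hz => (hsupp i).1 hz hzs
    simp [hz, hzs]
  have hgrad : Dᵀ.mulVec (D.mulVec z - y) + lam • s = (Dᵀ * D).mulVec (z - zstar) := by
    rw [← sub_zero (_ + lam • s), ← hopt, ← mulVec_mulVec, mulVec_sub D, mulVec_sub, mulVec_sub,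
      mulVec_sub]
    abel
  have hdecomp : g2 - gstar = RmapLin D y zstar J (supp zstar) (z - zstar)
      + vecMulVec (D.mulVec (z - zstar)) (z - zstar) := by
    ext l j
    simp only [hg2, hgstar, hgrad, RmapLin, LinearMap.coe_mk, AddHom.coe_mk, Rmap, hres,
      Matrix.sub_apply, Matrix.add_apply, of_apply, vecMulVec_apply, mulVec_sub D, Pi.sub_apply]
    ring
  calc frobnorm (g2 - gstar)
      ≤ frobnorm (RmapLin D y zstar J (supp zstar) (z - zstar))
        + eunorm (D.mulVec (z - zstar)) * eunorm (z - zstar) := by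
        rw [hdecomp, ← frobnorm_vecMulVec]
        exact frobnorm_add_le _ _
    _ ≤ mapOpNorm (Rmap D y zstar J (supp zstar)) * eunorm (z - zstar)
        + l2opnorm D * eunorm (z - zstar) * eunorm (z - zstar) :=
        add_le_add (frobnorm_map_le (RmapLin D y zstar J (supp zstar)) _)
          (mul_le_mul_of_nonneg_right (eunorm_mulVec_le D _) (eunorm_nonneg _))
    _ = _ := by ring
end

section
/- Fix a row index l, constants L > 0 and λ > 0. For w ∈ ℝⁿ let D(w) denote the m×n matrix obtained from D by replacing its l-th row with wᵀ, so D(D_l) = D. Let ζ : ℝⁿ → ℝⁿ be Fréchet differentiable at w₀ = D_l with derivative represented by the n×n matrix J (entries J_{ik} = ∂ζ_i/∂w_k). Set z = ζ(w₀), u = z − (1/L) Dᵀ(Dz − y), z⁺ = ST_{λ/L}(u), and define ζ⁺(w) = ST_{λ/L}(ζ(w) − (1/L) D(w)ᵀ(D(w) ζ(w) − y)). If |u_i| ≠ λ/L for every coordinate i, then ζ⁺ is Fréchet differentiable at w₀ and its derivative is the n×n matrix diag(1_{|z⁺| > 0}) · ( J − (1/L)( D_l zᵀ + (D_lᵀ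 z − y_l) I_n + DᵀD J ) ), where diag(1_{|z⁺| > 0}) is the diagonal matrix whose (i,i) entry is 1 if z⁺_i ≠ 0 and 0 otherwise. -/
open scoped BigOperators
open Matrix

theorem hasDerivAt_softThreshold {μ a : ℝ} (hμ : 0 < μ) (ha : |a| ≠ μ) :
    HasDerivAt (fun x : ℝ => Real.sign x * max (|x| - μ) 0)
      (if Real.sign a * max (|a| - μ) 0 = 0 then (0 : ℝ) else 1) a := by
  rcases lt_or_gt_of_ne ha with h | h
  · rw [if_pos (by rw [max_eq_right (by linarith), mul_zero])]
    refine (hasDerivAt_const a (0 : ℝ)).congr_of_eventuallyEq ?_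
    filter_upwards [continuous_abs.continuousAt.eventually_lt continuousAt_const h] with x hx
    rw [max_eq_right (by linarith), mul_zero]
  · rcases lt_abs.1 h with h' | h'
    · rw [if_neg (by
        rw [max_eq_left (by linarith), Real.sign_of_pos (by linarith)]
        linarith)]
      refine ((hasDerivAt_id a).sub_const μ).congr_of_eventuallyEq ?_
      filter_upwards [lt_mem_nhds h'] with x hx
      rw [Real.sign_of_pos (by linarith), abs_of_pos (by linarith),
        max_eq_left (by linarith), one_mul, id]
    · rw [if_neg (by
        rw [max_eq_left (by linarith), Real.sign_of_neg (by linarith)]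
        linarith)]
      refine ((hasDerivAt_id a).add_const μ).congr_of_eventuallyEq ?_
      filter_upwards [gt_mem_nhds (show a < -μ by linarith)] with x hx
      rw [Real.sign_of_neg (by linarith), abs_of_neg (by linarith),
        max_eq_left (by linarith), id]
      ring

theorem updateRow_transpose_mulVec_residual {m n : ℕ} (D : Matrix (Fin m) (Fin n) ℝ)
    (y : Fin m → ℝ) (l : Fin m) (w x : Fin n → ℝ) :
    (Matrix.updateRow D l w)ᵀ.mulVec ((Matrix.updateRow D l w).mulVec x - y) =
      Dᵀ.mulVec (D.mulVec x - y) + (w ⬝ᵥ x - y l) • w - (D l ⬝ᵥ x - y l) • D l := by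
  ext i
  simp only [Matrix.mulVec, dotProduct, Matrix.transpose_apply, Pi.add_apply, Pi.sub_apply,
    Pi.smul_apply, smul_eq_mul]
  rw [← Finset.add_sum_erase _ _ (Finset.mem_univ l),
    ← Finset.add_sum_erase (a := l) _ (fun k => D k i * (∑ j, D k j * x j - y k))
      (Finset.mem_univ l)]
  rw [Finset.sum_congr rfl (g := fun k => D k i * (∑ j, D k j * x j - y k)) fun k hk => by
    simp [Matrix.updateRow_ne (Finset.ne_of_mem_erase hk)]]
  simp only [Matrix.updateRow_self]
  ring

theorem hasFDerivAt_updateRow_transpose_mulVec_residual {m n : ℕ}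
    (D : Matrix (Fin m) (Fin n) ℝ) (y : Fin m → ℝ) (l : Fin m)
    {ζ : (Fin n → ℝ) → (Fin n → ℝ)} {J : Matrix (Fin n) (Fin n) ℝ}
    (hζ : HasFDerivAt ζ (LinearMap.toContinuousLinearMap (Matrix.mulVecLin J)) (D l)) :
    HasFDerivAt (fun w => (Matrix.updateRow D l w)ᵀ.mulVec
        ((Matrix.updateRow D l w).mulVec (ζ w) - y))
      (LinearMap.toContinuousLinearMap (Matrix.mulVecLin
        (Matrix.vecMulVec (D l) (ζ (D l))
          + (D l ⬝ᵥ ζ (D l) - y l) • (1 : Matrix (Fin n) (Fin n) ℝ) + Dᵀ * D * J)))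
      (D l) := by
  simp only [updateRow_transpose_mulVec_residual]
  have hcoord : ∀ j, HasFDerivAt (fun w => ζ w j) _ (D l) := hasFDerivAt_pi'.1 hζ
  have hD : HasFDerivAt (fun w => Dᵀ.mulVec (D.mulVec (ζ w) - y)) _ (D l) :=
    (LinearMap.toContinuousLinearMap (Matrix.mulVecLin Dᵀ)).hasFDerivAt.comp (D l)
      (((LinearMap.toContinuousLinearMap (Matrix.mulVecLin D)).hasFDerivAt.comp (D l)
        hζ).sub_const y)
  have hw : HasFDerivAt (fun w : Fin n → ℝ => w ⬝ᵥ ζ w) _ (D l) :=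
    HasFDerivAt.fun_sum fun j _ => (hasFDerivAt_apply j (D l)).mul (hcoord j)
  have hd : HasFDerivAt (fun w : Fin n → ℝ => D l ⬝ᵥ ζ w) _ (D l) :=
    HasFDerivAt.fun_sum fun j _ => (hcoord j).const_mul (D l j)
  refine ((hD.add ((hw.sub_const (y l)).smul (hasFDerivAt_id (D l)))).sub
    ((hd.sub_const (y l)).smul_const (D l))).congr_fderiv ?_
  ext1 h
  ext i
  simp [Matrix.vecMulVec_mulVec, Finset.sum_add_distrib, add_mul, dotProduct]
  ring

/-- differentiating one step of ISTA with respect to the l-th row of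
the dictionary (the induction of Theorem 1 of the paper). -/
theorem ista_step_jacobian_induction
    {m n : ℕ} (D : Matrix (Fin m) (Fin n) ℝ) (y : Fin m → ℝ) (l : Fin m)
    (L lam : ℝ) (hL : 0 < L) (hlam : 0 < lam)
    (ζ : (Fin n → ℝ) → (Fin n → ℝ)) (J : Matrix (Fin n) (Fin n) ℝ)
    (hζ : HasFDerivAt ζ (LinearMap.toContinuousLinearMap (Matrix.mulVecLin J)) (D l))
    (z u zplus : Fin n → ℝ)
    (hz : z = ζ (D l))
    (hu : u = z - (1 / L) • (Dᵀ.mulVec (D.mulVec z - y)))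
    (hzplus : zplus = STv (lam / L) u)
    (ζplus : (Fin n → ℝ) → (Fin n → ℝ))
    (hζplus : ∀ w, ζplus w = STv (lam / L)
      (ζ w - (1 / L) • ((Matrix.updateRow D l w)ᵀ.mulVec
        ((Matrix.updateRow D l w).mulVec (ζ w) - y))))
    (hu_ne : ∀ i, |u i| ≠ lam / L) :
    HasFDerivAt ζplus
      (LinearMap.toContinuousLinearMap (Matrix.mulVecLin
        (Matrix.diagonal (fun i => if zplus i = 0 then (0 : ℝ) else 1) *
          (J - (1 / L) • (Matrix.vecMulVec (D l) z
            + (dotProduct (D l) z - y l) • (1 : Matrix (Fin n) (Fin n) ℝ)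
            + Dᵀ * D * J)))))
      (D l) := by
  have hv : HasFDerivAt (fun w => ζ w - (1 / L) • ((Matrix.updateRow D l w)ᵀ.mulVec
      ((Matrix.updateRow D l w).mulVec (ζ w) - y))) _ (D l) :=
    hζ.sub ((hasFDerivAt_updateRow_transpose_mulVec_residual D y l hζ).const_smul (1 / L))
  have hu' : ζ (D l) - (1 / L) • ((Matrix.updateRow D l (D l))ᵀ.mulVec
      ((Matrix.updateRow D l (D l)).mulVec (ζ (D l)) - y)) = u := by
    rw [Matrix.updateRow_eq_self, hu, hz]
  obtain rfl : ζplus = _ := funext hζplus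
  subst hz
  obtain ⟨c, hc⟩ : ∃ c : Fin n → ℝ, c = fun i => if zplus i = 0 then 0 else 1 := ⟨_, rfl⟩
  rw [← hc]
  refine hasFDerivAt_pi'.2 fun i => ?_
  have hst : HasDerivAt (fun x : ℝ => Real.sign x * max (|x| - lam / L) 0) (c i) (u i) := by
    rw [hc, hzplus]
    exact hasDerivAt_softThreshold (div_pos hlam hL) (hu_ne i)
  rw [← hu'] at hst
  refine (hst.comp_hasFDerivAt (D l) (hasFDerivAt_pi'.1 hv i)).congr_fderiv ?_
  ext1 h
  simp [Matrix.mulVec_diagonal]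
end

section
/- Let L ≠ 0, let z* ∈ ℝⁿ, let S* ⊆ {1,…,n} be such that the Gram matrix (D_{:,S*})ᵀ D_{:,S*} is invertible, and fix a row index l. Then the equation M = 1_{S*} ⊙ ( M − (1/L)( D_l (z*)ᵀ + (D_lᵀ z* − y_l) I_n + DᵀD M ) ) in the unknown n×n matrix M has a unique solution, namely M = J*_l: the matrix whose rows outside S* are zero and whose block of rows indexed by S* equals −((D_{:,S*})ᵀ D_{:,S*})⁻¹ times the S*-rows of the n×n matrix D_l(z*)ᵀ + (D_lᵀ z* − y_l) I_n. In other words, the closed-form matrix J*_l is the unique fixed point of the unrolled ISTA Jacobian recursion with mask S*. -/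
open scoped BigOperators
open Matrix

theorem eq_rowMask_sub_smul_iff {n : ℕ} {S : Finset (Fin n)} {c : ℝ} (hc : c ≠ 0)
    (M A : Matrix (Fin n) (Fin n) ℝ) :
    M = rowMask S (M - c • A) ↔
      (∀ i ∉ S, ∀ j, M i j = 0) ∧
        A.submatrix (Subtype.val : {i // i ∈ S} → Fin n) id = 0 := by
  constructor
  · intro h
    have hij : ∀ i j, M i j = if i ∈ S then M i j - c * A i j else 0 := fun i j => by
      simpa [rowMask] using congrFun (congrFun h i) j
    refine ⟨fun i hi j => by simpa [hi] using hij i j, ?_⟩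
    ext ⟨i, hi⟩ j
    have hMij : M i j = M i j - c * A i j := by simpa only [if_pos hi] using hij i j
    have hcA : c * A i j = 0 := by linarith
    exact (mul_eq_zero.mp hcA).resolve_left hc
  · rintro ⟨h0, hA⟩
    ext i j
    by_cases hi : i ∈ S
    · have hAij : A i j = 0 := congrFun (congrFun hA ⟨i, hi⟩) j
      simp [rowMask, hi, hAij]
    · simp [rowMask, hi, h0 i hi j]

theorem eq_Jstar_iff {m n : ℕ} (D : Matrix (Fin m) (Fin n) ℝ) (y : Fin m → ℝ)
    (l : Fin m) (z : Fin n → ℝ) (S : Finset (Fin n)) (M : Matrix (Fin n) (Fin n) ℝ) :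
    M = Jstar D y l z S ↔
      (∀ i ∉ S, ∀ j, M i j = 0) ∧
        M.submatrix (Subtype.val : {i // i ∈ S} → Fin n) id =
          -((gram D S)⁻¹ *
            (Nmat D y l z).submatrix (Subtype.val : {i // i ∈ S} → Fin n) id) := by
  constructor
  · rintro rfl
    refine ⟨fun i hi j => by simp [Jstar, hi], ?_⟩
    ext ⟨i, hi⟩ j
    simp [Jstar, hi]
  · rintro ⟨h0, hM⟩
    ext i j
    by_cases hi : i ∈ S
    · have hMij := congrFun (congrFun hM ⟨i, hi⟩) j
      simpa [Jstar, hi] using hMij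
    · simp [Jstar, hi, h0 i hi j]

theorem submatrix_transpose_mul_self_mul {m n : ℕ} (D : Matrix (Fin m) (Fin n) ℝ)
    {S : Finset (Fin n)} {M : Matrix (Fin n) (Fin n) ℝ} (hM : ∀ i ∉ S, ∀ j, M i j = 0) :
    (Dᵀ * D * M).submatrix (Subtype.val : {i // i ∈ S} → Fin n) id =
      gram D S * M.submatrix (Subtype.val : {i // i ∈ S} → Fin n) id := by
  ext i j
  have hsum : ∑ k ∈ S, (Dᵀ * D) i k * M k j = ∑ k, (Dᵀ * D) i k * M k j :=
    Finset.sum_subset (Finset.subset_univ S) fun k _ hk => by simp [hM k hk j]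
  rw [Matrix.submatrix_apply, Matrix.mul_apply, id, ← hsum, ← Finset.sum_coe_sort,
    Matrix.mul_apply]
  rfl

/-- the closed-form Jacobian `J*_l` is the unique fixed point of the
masked unrolled ISTA Jacobian recursion. -/
theorem jacobian_fixed_point_unique
    {m n : ℕ} (D : Matrix (Fin m) (Fin n) ℝ) (y : Fin m → ℝ) (l : Fin m)
    (L : ℝ) (hL : L ≠ 0) (zstar : Fin n → ℝ)
    (Sstar : Finset (Fin n))
    (hGram : IsUnit (gram D Sstar)) :
    ∀ M : Matrix (Fin n) (Fin n) ℝ,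
      (M = rowMask Sstar (M - (1 / L) •
          (Matrix.vecMulVec (D l) zstar
            + (dotProduct (D l) zstar - y l) • (1 : Matrix (Fin n) (Fin n) ℝ)
            + Dᵀ * D * M)))
        ↔ M = Jstar D y l zstar Sstar := by
  intro M
  rw [eq_rowMask_sub_smul_iff (one_div_ne_zero hL), eq_Jstar_iff]
  refine and_congr_right fun h0 => ?_
  have hdet : IsUnit (gram D Sstar).det := (Matrix.isUnit_iff_isUnit_det _).mp hGram
  rw [← Nmat, Matrix.submatrix_add, Pi.add_apply, Pi.add_apply,
    submatrix_transpose_mul_self_mul D h0, add_comm, add_eq_zero_iff_eq_neg, ← Matrix.mul_neg]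
  constructor
  · intro h
    rw [← h, Matrix.nonsing_inv_mul_cancel_left _ _ hdet]
  · intro h
    rw [h, Matrix.mul_nonsing_inv_cancel_left _ _ hdet]
end

section
/- Let z* ∈ ℝⁿ with S* = supp(z*), assume the Gram matrix (D_{:,S*})ᵀ D_{:,S*} is invertible, and for each l ∈ {1,…,m} let J*_l be the n×n matrix whose rows outside S* are zero and whose S*-rows equal −((D_{:,S*})ᵀ D_{:,S*})⁻¹ times the S*-rows of D_l(z*)ᵀ + (D_lᵀ z* − y_l) I_n. Then for every l, the rows indexed by S* of the n×n matrix DᵀD J*_l + D_l(z*)ᵀ + (D_lᵀ z* − y_l) I_n are zero. Consequently, for every h ∈ ℝⁿ supported on S* and every l, (J*_l)ᵀ(DᵀD h) + (Dh)_l z* + (Dz* − y)_l h = 0 in ℝⁿ; that is, the linear map R(J*, S*) is identically zero. -/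
open scoped BigOperators
open Matrix

theorem gram_apply {m n : ℕ} (D : Matrix (Fin m) (Fin n) ℝ) (S : Finset (Fin n))
    (i k : {i // i ∈ S}) : gram D S i k = (Dᵀ * D) i k := by
  simp [_root_.gram, colSub, Matrix.mul_apply]

theorem transpose_mul_self_mul_Jstar_add_Nmat_apply {m n : ℕ} (D : Matrix (Fin m) (Fin n) ℝ)
    (y : Fin m → ℝ) (l : Fin m) (z : Fin n → ℝ) {S : Finset (Fin n)}
    (hS : IsUnit (gram D S)) {i : Fin n} (hi : i ∈ S) (j : Fin n) :
    (Dᵀ * D * Jstar D y l z S + Nmat D y l z) i j = 0 := by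
  set N := (Nmat D y l z).submatrix (Subtype.val : {i // i ∈ S} → Fin n) id with hN
  have hsum : (Dᵀ * D * Jstar D y l z S) i j = (gram D S * -((gram D S)⁻¹ * N)) ⟨i, hi⟩ j := by
    rw [Matrix.mul_apply, Matrix.mul_apply,
      ← Finset.sum_subset (Finset.subset_univ S)
        (fun k _ hk => by simp [Jstar, hk]), ← Finset.sum_coe_sort S]
    refine Finset.sum_congr rfl fun k _ => ?_
    rw [gram_apply]
    simp [Jstar, hN]
  rw [Matrix.add_apply, hsum, Matrix.mul_neg,
    Matrix.mul_nonsing_inv_cancel_left _ _ ((Matrix.isUnit_iff_isUnit_det _).mp hS)]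
  simp [hN]

theorem vecMul_Nmat {m n : ℕ} (D : Matrix (Fin m) (Fin n) ℝ) (y : Fin m → ℝ)
    (l : Fin m) (z h : Fin n → ℝ) :
    h ᵥ* Nmat D y l z = (D *ᵥ h) l • z + (D *ᵥ z - y) l • h := by
  rw [Nmat, Matrix.vecMul_add, Matrix.vecMul_vecMulVec, Matrix.vecMul_smul, Matrix.vecMul_one,
    dotProduct_comm h]
  rfl

/-- the closed-form Jacobian annihilates the normal equations on the
support; consequently `R(J*, S*) = 0` (Theorem 1 of the paper). -/
theorem Rmap_of_closed_form_jacobian_eq_zero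
    {m n : ℕ} (D : Matrix (Fin m) (Fin n) ℝ) (y : Fin m → ℝ)
    (zstar : Fin n → ℝ)
    (hGram : IsUnit (gram D (supp zstar))) :
    (∀ l : Fin m, ∀ i ∈ supp zstar, ∀ j : Fin n,
        (Dᵀ * D * Jstar D y l zstar (supp zstar) + Nmat D y l zstar) i j = 0)
      ∧ (∀ h : Fin n → ℝ, (∀ i, i ∉ supp zstar → h i = 0) → ∀ l : Fin m,
          (Jstar D y l zstar (supp zstar))ᵀ.mulVec ((Dᵀ * D).mulVec h)
            + (D.mulVec h) l • zstar + (D.mulVec zstar - y) l • h = 0) := by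
  have hrow := fun l i (hi : i ∈ supp zstar) j =>
    transpose_mul_self_mul_Jstar_add_Nmat_apply D y l zstar hGram hi j
  refine ⟨hrow, fun h hh l => ?_⟩
  have hsymm : (Dᵀ * D) *ᵥ h = h ᵥ* (Dᵀ * D) := by
    rw [← Matrix.mulVec_transpose, Matrix.transpose_mul, Matrix.transpose_transpose]
  rw [add_assoc, ← vecMul_Nmat, hsymm, Matrix.mulVec_transpose, Matrix.vecMul_vecMul,
    ← Matrix.vecMul_add]
  ext j
  rw [Matrix.vecMul_eq_sum, Finset.sum_apply]
  refine Finset.sum_eq_zero fun i _ => ?_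
  by_cases hi : i ∈ supp zstar
  · rw [Pi.smul_apply, hrow l i hi j, smul_zero]
  · rw [hh i hi, zero_smul, Pi.zero_apply]
end

section
/- Let L > 0, fix a row index l, let z* ∈ ℝⁿ with S* = supp(z*), assume (D_{:,S*})ᵀ D_{:,S*} is invertible, and let J*_l be the closed-form Jacobian. Let z ∈ ℝⁿ, let S ⊆ {1,…,n} with S* ⊆ S, set Ē = S \ S*, and let J be any n×n matrix. Define one step of the masked recursion J' = 1_S ⊙ (G J + u^z). Then J' − J*_l = 1_S ⊙ ( G (J − J*_l) + (u^z − u^{z*}) ) + M, where M is the n×n matrix whose rows outside Ē are zero and whose Ē-rows equal the corresponding rows of u^{z*} minus (D_{:,Ē})ᵀ D_{:,S*}((D_{:,S*})ᵀ D_{:,S*})⁻¹ times the S*-rows of u^{z*}. -/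
open scoped BigOperators
open Matrix

theorem mul_Jstar {m n : ℕ} (D : Matrix (Fin m) (Fin n) ℝ) (y : Fin m → ℝ) (l : Fin m)
    (z : Fin n → ℝ) (S : Finset (Fin n)) :
    D * Jstar D y l z S =
      colSub D S * -((gram D S)⁻¹ *
        (Nmat D y l z).submatrix (Subtype.val : {i // i ∈ S} → Fin n) id) := by
  ext k j
  rw [Matrix.mul_apply, Matrix.mul_apply,
    ← Finset.sum_subset (Finset.subset_univ S) fun i _ hi => by simp [Jstar, hi],
    ← Finset.sum_coe_sort S]
  refine Finset.sum_congr rfl fun i _ => ?_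
  simp [Jstar, colSub]

theorem transpose_mul_self_mul_Jstar_apply_of_mem {m n : ℕ} (D : Matrix (Fin m) (Fin n) ℝ)
    (y : Fin m → ℝ)
    (l : Fin m) (z : Fin n → ℝ) (S : Finset (Fin n)) (hGram : IsUnit (gram D S))
    {i : Fin n} (hi : i ∈ S) (j : Fin n) :
    (Dᵀ * D * Jstar D y l z S) i j = -Nmat D y l z i j := by
  have h : (Dᵀ * D * Jstar D y l z S) i j =
      ((colSub D S)ᵀ * (colSub D S *
        -((gram D S)⁻¹ *
          (Nmat D y l z).submatrix (Subtype.val : {i // i ∈ S} → Fin n) id))) ⟨i, hi⟩ j := by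
    rw [Matrix.mul_assoc, mul_Jstar]
    rfl
  rw [h, ← Matrix.mul_assoc, ← _root_.gram, Matrix.mul_neg, ← Matrix.mul_assoc,
    Matrix.mul_nonsing_inv _ ((Matrix.isUnit_iff_isUnit_det _).mp hGram), Matrix.one_mul]
  rfl

theorem transpose_mul_self_mul_Jstar_apply {m n : ℕ} (D : Matrix (Fin m) (Fin n) ℝ)
    (y : Fin m → ℝ)
    (l : Fin m) (z : Fin n → ℝ) (S E : Finset (Fin n))
    {i : Fin n} (hi : i ∈ E) (j : Fin n) :
    (Dᵀ * D * Jstar D y l z S) i j =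
      -((colSub D E)ᵀ * colSub D S * (gram D S)⁻¹ *
        (Nmat D y l z).submatrix (Subtype.val : {i // i ∈ S} → Fin n) id) ⟨i, hi⟩ j := by
  have h : (Dᵀ * D * Jstar D y l z S) i j =
      ((colSub D E)ᵀ * (colSub D S *
        -((gram D S)⁻¹ *
          (Nmat D y l z).submatrix (Subtype.val : {i // i ∈ S} → Fin n) id))) ⟨i, hi⟩ j := by
    rw [Matrix.mul_assoc, mul_Jstar]
    rfl
  rw [h, Matrix.mul_neg, Matrix.mul_neg, Matrix.neg_apply]
  simp only [Matrix.mul_assoc]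

theorem Gmat_mul_apply {m n : ℕ} (D : Matrix (Fin m) (Fin n) ℝ) (L : ℝ)
    (A : Matrix (Fin n) (Fin n) ℝ) (i j : Fin n) :
    (Gmat D L * A) i j = A i j - 1 / L * (Dᵀ * D * A) i j := by
  rw [Gmat, Matrix.sub_mul, Matrix.one_mul, Matrix.smul_mul]
  rfl

/-- one-step error decomposition of the masked Jacobian
recursion. -/
theorem jacobian_recursion_one_step_decomposition
    {m n : ℕ} (D : Matrix (Fin m) (Fin n) ℝ) (y : Fin m → ℝ) (l : Fin m)
    (L : ℝ) (hL : 0 < L) (zstar : Fin n → ℝ)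
    (hGram : IsUnit (gram D (supp zstar)))
    (z : Fin n → ℝ) (S : Finset (Fin n)) (hS : supp zstar ⊆ S)
    (J J' : Matrix (Fin n) (Fin n) ℝ)
    (hJ' : J' = rowMask S (Gmat D L * J + umat D y l L z)) :
    J' - Jstar D y l zstar (supp zstar) =
      rowMask S (Gmat D L * (J - Jstar D y l zstar (supp zstar))
          + (umat D y l L z - umat D y l L zstar))
        + Mmat D (supp zstar) (S \ supp zstar) (umat D y l L zstar) := by
  subst hJ'
  ext i j
  simp only [Matrix.sub_apply, Matrix.add_apply, rowMask, Matrix.of_apply, Matrix.mul_sub]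
  by_cases hiS : i ∈ S
  · rw [if_pos hiS, if_pos hiS, Gmat_mul_apply D L (Jstar _ _ _ _ _)]
    by_cases hi : i ∈ supp zstar
    · have hE : i ∉ S \ supp zstar := fun h => (Finset.mem_sdiff.mp h).2 hi
      rw [transpose_mul_self_mul_Jstar_apply_of_mem D y l zstar _ hGram hi]
      simp only [Mmat, umat, Matrix.of_apply, dif_neg hE, Matrix.smul_apply, smul_eq_mul]
      ring
    · have hE : i ∈ S \ supp zstar := Finset.mem_sdiff.mpr ⟨hiS, hi⟩
      have hJ : Jstar D y l zstar (supp zstar) i j = 0 := by simp [Jstar, hi]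
      rw [transpose_mul_self_mul_Jstar_apply D y l zstar _ _ hE, hJ]
      simp only [Mmat, umat, Matrix.of_apply, dif_pos hE, Matrix.submatrix_smul, Pi.smul_apply,
        Matrix.mul_smul, Matrix.smul_apply, smul_eq_mul]
      ring
  · have hi : i ∉ supp zstar := fun h => hiS (hS h)
    simp [Jstar, Mmat, hiS, hi]
end

section
/- Let A be a real symmetric positive semidefinite n×n matrix and let L > 0 satisfy λ_max(A) ≤ L. Let S ⊆ {1,…,n} and let μ be the smallest eigenvalue of the principal submatrix A_{S,S}. Then for any subsets S₁, S₂ ⊆ S, the ℓ²-operator norm of the submatrix of I_n − (1/L)A with rows in S₁ and columns in S₂ is at most 1 − μ/L. In particular, for a real m×n matrix D with ‖D‖² ≤ L and A = DᵀD, the blocks of I_n − (1/L)DᵀD indexed by subsets of S contract with factor 1 − μ/L, where μ is the smallest eigenvalue of (D_{:,S})ᵀ D_{:,S}. -/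
open scoped BigOperators
open Matrix

theorem Matrix.IsHermitian.posSemidef_smul_one_add_smul {ι : Type*} [Fintype ι] [DecidableEq ι]
    {A : Matrix ι ι ℝ} (hA : A.IsHermitian) (a b : ℝ)
    (h : ∀ i, 0 ≤ a + b * hA.eigenvalues i) :
    (a • (1 : Matrix ι ι ℝ) + b • A).PosSemidef := by
  set U := hA.eigenvectorUnitary
  have hU : (U : Matrix ι ι ℝ) * star (U : Matrix ι ι ℝ) = 1 := Unitary.coe_mul_star_self U
  have hspec : A = (U : Matrix ι ι ℝ) * diagonal hA.eigenvalues * star (U : Matrix ι ι ℝ) :=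
    hA.spectral_theorem
  have hdiag : diagonal (fun i => a + b * hA.eigenvalues i)
      = a • (1 : Matrix ι ι ℝ) + b • diagonal hA.eigenvalues := by
    ext i j
    by_cases hij : i = j <;> simp [hij]
  have key : a • (1 : Matrix ι ι ℝ) + b • A = (U : Matrix ι ι ℝ) *
      diagonal (fun i => a + b * hA.eigenvalues i) * (U : Matrix ι ι ℝ)ᴴ := by
    rw [hdiag, ← star_eq_conjTranspose, Matrix.mul_add, Matrix.add_mul, Matrix.mul_smul,
      Matrix.smul_mul, Matrix.mul_smul, Matrix.smul_mul, Matrix.mul_one, hU, ← hspec]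
  rw [key]
  exact (posSemidef_diagonal_iff.mpr h).mul_mul_conjTranspose_same _

theorem Matrix.PosSemidef.dotProduct_mulVec_self_le {ι : Type*} [Fintype ι] [DecidableEq ι]
    {B : Matrix ι ι ℝ} (hB : B.PosSemidef) {c : ℝ} (hc : 0 ≤ c)
    (hcB : (c • (1 : Matrix ι ι ℝ) - B).PosSemidef) (x : ι → ℝ) :
    (B *ᵥ x) ⬝ᵥ (B *ᵥ x) ≤ c ^ 2 * (x ⬝ᵥ x) := by
  have hle : ∀ y : ι → ℝ, y ⬝ᵥ (B *ᵥ y) ≤ c * (y ⬝ᵥ y) := fun y => by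
    have := hcB.dotProduct_mulVec_nonneg y
    simp only [star_trivial, sub_mulVec, smul_mulVec, one_mulVec, dotProduct_sub,
      dotProduct_smul, smul_eq_mul] at this
    linarith
  have hsymm : x ⬝ᵥ (B *ᵥ (B *ᵥ x)) = (B *ᵥ x) ⬝ᵥ (B *ᵥ x) := by
    have hT : Bᵀ = B := by simpa using hB.isHermitian.eq
    rw [dotProduct_mulVec, ← mulVec_transpose, hT]
  have hq : ∀ t : ℝ, 0 ≤ c * (x ⬝ᵥ x) - 2 * t * ((B *ᵥ x) ⬝ᵥ (B *ᵥ x))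
      + t ^ 2 * (c * ((B *ᵥ x) ⬝ᵥ (B *ᵥ x))) := fun t => by
    have h := hB.dotProduct_mulVec_nonneg (x - t • (B *ᵥ x))
    simp only [star_trivial, mulVec_sub, mulVec_smul, dotProduct_sub, sub_dotProduct,
      dotProduct_smul, smul_dotProduct, smul_eq_mul, hsymm] at h
    nlinarith [hle x, mul_le_mul_of_nonneg_left (hle (B *ᵥ x)) (sq_nonneg t)]
  rcases hc.eq_or_lt with rfl | hc
  · linarith [hq 1]
  · have h := mul_nonneg (sq_nonneg c) (hq c⁻¹)
    field_simp at h
    nlinarith [h]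

theorem eunorm_eq_sqrt_dotProduct {α : Type*} [Fintype α] (v : α → ℝ) :
    eunorm v = Real.sqrt (v ⬝ᵥ v) := by
  simp [eunorm, dotProduct, pow_two]

theorem eunorm_comp_le {α β : Type*} [Fintype α] [Fintype β] {f : α → β}
    (hf : Function.Injective f) (v : β → ℝ) : eunorm (v ∘ f) ≤ eunorm v := by
  classical
  refine Real.sqrt_le_sqrt ?_
  simp only [Function.comp_apply]
  rw [← Finset.sum_image (s := Finset.univ) (g := f) (f := fun i => v i ^ 2)
    (fun _ _ _ _ h => hf h)]
  exact Finset.sum_le_sum_of_subset_of_nonneg (Finset.subset_univ _) fun _ _ _ => sq_nonneg _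

theorem l2opnorm_submatrix_le {α β ι : Type*} [Fintype α] [Fintype β] [Fintype ι]
    {B : Matrix ι ι ℝ} {c : ℝ} (hc : 0 ≤ c) (hB : ∀ x, eunorm (B *ᵥ x) ≤ c * eunorm x)
    {f : α → ι} {g : β → ι} (hf : Function.Injective f) (hg : Function.Injective g) :
    l2opnorm (B.submatrix f g) ≤ c := by
  refine csInf_le ⟨0, fun _ h => h.1⟩ ⟨hc, fun v => ?_⟩
  have hzero : ∀ i ∉ Set.range g, Function.extend g v 0 i = 0 := fun i hi =>
    Function.extend_apply' _ _ _ (by simpa using hi)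
  have hmul : B.submatrix f g *ᵥ v = (B *ᵥ Function.extend g v 0) ∘ f := by
    ext i
    refine Fintype.sum_of_injective g hg _ _ (fun j hj => ?_) fun j => ?_
    · simp [hzero j hj]
    · simp [hg.extend_apply]
  have hnorm : eunorm (Function.extend g v 0) = eunorm v := by
    refine congrArg Real.sqrt (Fintype.sum_of_injective g hg _ _ (fun j hj => ?_) fun j => ?_).symm
    · simp [hzero j hj]
    · simp [hg.extend_apply]
  rw [hmul, ← hnorm]
  exact (eunorm_comp_le hf _).trans (hB _)

/-- blocks of `I − A/L` indexed by subsets of `S` contract with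
factor `1 − μ/L`, where `μ` is the smallest eigenvalue of `A_{S,S}`. -/
theorem submatrix_contraction_bound
    {n : ℕ} (A : Matrix (Fin n) (Fin n) ℝ) (hA : A.PosSemidef)
    (L : ℝ) (hL : 0 < L)
    (hAmax : ∀ i, hA.isHermitian.eigenvalues i ≤ L)
    (S : Finset (Fin n))
    (hAS : (A.submatrix (Subtype.val : {i // i ∈ S} → Fin n)
      (Subtype.val : {i // i ∈ S} → Fin n)).IsHermitian)
    (μ : ℝ)
    (hμle : ∀ i, μ ≤ hAS.eigenvalues i)
    (hμmem : ∃ i, hAS.eigenvalues i = μ)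
    (S₁ S₂ : Finset (Fin n)) (h1 : S₁ ⊆ S) (h2 : S₂ ⊆ S) :
    l2opnorm (((1 : Matrix (Fin n) (Fin n) ℝ) - (1 / L) • A).submatrix
        (Subtype.val : {i // i ∈ S₁} → Fin n) (Subtype.val : {i // i ∈ S₂} → Fin n))
      ≤ 1 - μ / L := by
  set B : Matrix {i // i ∈ S} {i // i ∈ S} ℝ := (1 - (1 / L) • A).submatrix Subtype.val Subtype.val
    with hBdef
  have hB : B.PosSemidef := by
    have h := hA.isHermitian.posSemidef_smul_one_add_smul 1 (-(1 / L)) fun i => by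
      have : hA.isHermitian.eigenvalues i / L ≤ 1 := (div_le_one hL).mpr (hAmax i)
      rw [neg_mul, one_div_mul_eq_div]
      linarith
    rw [one_smul, neg_smul, ← sub_eq_add_neg] at h
    exact h.submatrix _
  have hcB : ((1 - μ / L) • (1 : Matrix {i // i ∈ S} {i // i ∈ S} ℝ) - B).PosSemidef := by
    have h := hAS.posSemidef_smul_one_add_smul (-(μ / L)) (1 / L) fun i => by
      have : μ / L ≤ hAS.eigenvalues i / L := by gcongr; exact hμle i
      rw [one_div_mul_eq_div]
      linarith
    convert h using 1
    rw [hBdef, submatrix_sub, submatrix_smul, Pi.sub_apply, Pi.sub_apply,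
      submatrix_one _ Subtype.val_injective, sub_smul, neg_smul, one_smul]
    simp only [Pi.smul_apply]
    abel
  have hc : 0 ≤ 1 - μ / L := by
    obtain ⟨i, -⟩ := hμmem
    have h := (hB.add hcB).diag_nonneg (i := i)
    simpa using h
  have hbound : ∀ x, eunorm (B *ᵥ x) ≤ (1 - μ / L) * eunorm x := fun x => by
    rw [eunorm_eq_sqrt_dotProduct, eunorm_eq_sqrt_dotProduct]
    refine (Real.sqrt_le_sqrt (hB.dotProduct_mulVec_self_le hc hcB x)).trans_eq ?_
    rw [Real.sqrt_mul (sq_nonneg _), Real.sqrt_sq hc]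
  exact l2opnorm_submatrix_le hc hbound
    (f := fun i : {i // i ∈ S₁} => ⟨i.1, h1 i.2⟩) (g := fun i : {i // i ∈ S₂} => ⟨i.1, h2 i.2⟩)
    (fun _ _ h => Subtype.ext (Subtype.mk.inj h))
    (fun _ _ h => Subtype.ext (Subtype.mk.inj h))
end
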